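/- arXiv:1901.11024 — 2 statements merged into one kernel-verified Lean document; each statement's English description precedes it below -/
import Mathlib

section
/- Let H be a finite-dimensional Hopf algebra over ℂ with involutive antipode (S∘S = id) and let h ∈ H be a normalized two-sided integral. Let T be the linear endomorphism of H ⊗ H ⊗ H determined by T(x⊗y⊗z) = x ⊗ h₁y ⊗ zS(h₂), and let U = {u ∈ H ⊗ H ⊗ H : T(u) = u}. Then U is contained in the image of the injective linear map θ : H ⊗ H → H ⊗ H ⊗ H, θ(a⊗b) = a ⊗ h₁ ⊗ bS(h₂); in particular dim_ℂ U ≤ (dim_ℂ H)². -/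
open TensorProduct

section HopfAlgebra

open HopfAlgebra Coalgebra

variable {R A ι : Type*} [CommSemiring R] [Semiring A] [HopfAlgebra R A]

/-- In a Hopf algebra, `a₁ ⊗ a₂S(a₃) = a ⊗ 1`. -/
lemma sum_comul_mul_one_tmul_antipode {a : A} (r : Repr R a ι) :
    ∑ i ∈ r.index, comul (R := R) (r.left i) * (1 ⊗ₜ[R] antipode R (r.right i)) =
      a ⊗ₜ[R] 1 := by
  let G : (A ⊗[R] A) ⊗[R] A →ₗ[R] A ⊗[R] A :=
    (LinearMap.mul' R A ∘ₗ (antipode R).lTensor A).lTensor A ∘ₗ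
      (TensorProduct.assoc R A A A).toLinearMap
  have hG (t : A ⊗[R] A) (b : A) : t * (1 ⊗ₜ[R] antipode R b) = G (t ⊗ₜ[R] b) := by
    induction t with
    | zero => simp
    | tmul x y => simp [G]
    | add x y hx hy => rw [add_mul, hx, hy, TensorProduct.add_tmul, map_add]
  calc
    _ = G (comul.rTensor A (comul (R := R) a)) := by simp [hG, ← r.eq]
    _ = ∑ i ∈ r.index, r.left i ⊗ₜ[R] algebraMap R A (counit (r.right i)) := by
      simp only [G, LinearMap.comp_apply, LinearEquiv.coe_coe, coassoc_apply]
      simp [← r.eq]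
    _ = (∑ i ∈ r.index, counit (R := R) (r.right i) • r.left i) ⊗ₜ[R] (1 : A) := by
      simp [Algebra.algebraMap_eq_smul_one, TensorProduct.sum_tmul, TensorProduct.smul_tmul]
    _ = a ⊗ₜ[R] 1 := by
      have := congr(TensorProduct.rid R A $(sum_tmul_counit_eq r))
      simp only [map_sum, TensorProduct.rid_tmul, one_smul] at this
      rw [this]

/-- If `h` is a right integral, then `h₁a ⊗ h₂ = h₁ ⊗ h₂S(a)`. -/
lemma comul_mul_tmul_one_of_mul_eq_counit_smul {h : A}
    (hh : ∀ x : A, h * x = counit (R := R) x • h) (a : A) :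
    comul (R := R) h * (a ⊗ₜ[R] 1) = comul (R := R) h * (1 ⊗ₜ[R] antipode R a) := by
  let r := ℛ R a
  calc
    _ = ∑ i ∈ r.index,
        comul (R := R) (h * r.left i) * (1 ⊗ₜ[R] antipode R (r.right i)) := by
      rw [← sum_comul_mul_one_tmul_antipode r, Finset.mul_sum]
      simp only [Bialgebra.comul_mul, mul_assoc]
    _ = comul (R := R) h *
        (1 ⊗ₜ[R] antipode R (∑ i ∈ r.index, counit (R := R) (r.left i) • r.right i)) := by
      simp [hh, TensorProduct.tmul_sum, Finset.mul_sum]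
    _ = _ := by rw [sum_counit_smul]

/-- If the antipode is involutive, then `S(a₂)a₁ = ε(a)1`. -/
lemma sum_antipode_right_mul_left (hS : ∀ x : A, antipode R (antipode R x) = x) {a : A}
    (r : Repr R a ι) :
    ∑ i ∈ r.index, antipode R (r.right i) * r.left i = counit (R := R) a • 1 := by
  simpa [antipode_mul_antidistrib, hS] using congr(antipode R $(sum_antipode_mul_eq_smul r))

end HopfAlgebra

/-- Let `H` be a finite-dimensional Hopf algebra over `ℂ` with involutive antipode and `h ∈ H` a
normalized two-sided integral.  Let `T : H⊗H⊗H → H⊗H⊗H` be determined by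
`T(x⊗y⊗z) = x ⊗ h₁y ⊗ zS(h₂)`, and `U = {u : T u = u}`.  Then `U` is contained in the image of
the injective linear map `θ : H⊗H → H⊗H⊗H`, `θ(a⊗b) = a ⊗ h₁ ⊗ bS(h₂)`; in particular
`dim_ℂ U ≤ (dim_ℂ H)²`. -/
theorem fixedPoints_subset_range_theta
    (H : Type*) [Ring H] [HopfAlgebra ℂ H] [FiniteDimensional ℂ H]
    (hS : ∀ x : H, HopfAlgebra.antipode (R := ℂ) (HopfAlgebra.antipode (R := ℂ) x) = x)
    (h : H)
    (hh_left : ∀ x : H, x * h = Coalgebra.counit (R := ℂ) x • h)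
    (hh_right : ∀ x : H, h * x = Coalgebra.counit (R := ℂ) x • h)
    (hh_one : Coalgebra.counit (R := ℂ) h = 1)
    (T : (H ⊗[ℂ] (H ⊗[ℂ] H)) →ₗ[ℂ] (H ⊗[ℂ] (H ⊗[ℂ] H)))
    (hT : ∀ (x y z : H) (ι : Type) (s : Finset ι) (h₁ h₂ : ι → H),
      Coalgebra.comul (R := ℂ) h = ∑ i ∈ s, h₁ i ⊗ₜ[ℂ] h₂ i →
      T (x ⊗ₜ[ℂ] (y ⊗ₜ[ℂ] z)) = ∑ i ∈ s,
        x ⊗ₜ[ℂ] ((h₁ i * y) ⊗ₜ[ℂ] (z * HopfAlgebra.antipode (R := ℂ) (h₂ i))))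
    (θ : (H ⊗[ℂ] H) →ₗ[ℂ] (H ⊗[ℂ] (H ⊗[ℂ] H)))
    (hθ : ∀ (a b : H) (ι : Type) (s : Finset ι) (h₁ h₂ : ι → H),
      Coalgebra.comul (R := ℂ) h = ∑ i ∈ s, h₁ i ⊗ₜ[ℂ] h₂ i →
      θ (a ⊗ₜ[ℂ] b) = ∑ i ∈ s,
        a ⊗ₜ[ℂ] (h₁ i ⊗ₜ[ℂ] (b * HopfAlgebra.antipode (R := ℂ) (h₂ i)))) :
    Function.Injective θ ∧
    {u : H ⊗[ℂ] (H ⊗[ℂ] H) | T u = u} ⊆ Set.range θ ∧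
    Set.finrank ℂ {u : H ⊗[ℂ] (H ⊗[ℂ] H) | T u = u} ≤ Module.finrank ℂ H ^ 2 := by
  obtain ⟨n, h₁, h₂, hr⟩ :=
    TensorProduct.exists_sum_tmul_eq (Coalgebra.comul (R := ℂ) h)
  let μ : H ⊗[ℂ] (H ⊗[ℂ] H) →ₗ[ℂ] H ⊗[ℂ] H :=
    (LinearMap.mul' ℂ H ∘ₗ (TensorProduct.comm ℂ H H).toLinearMap).lTensor H
  have hμ (x y z : H) : μ (x ⊗ₜ[ℂ] (y ⊗ₜ[ℂ] z)) = x ⊗ₜ[ℂ] (z * y) := by simp [μ]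
  have hμθ : μ ∘ₗ θ = LinearMap.id := by
    refine TensorProduct.ext' fun a b ↦ ?_
    have key := sum_antipode_right_mul_left hS
      (⟨Finset.univ, h₁, h₂, hr.symm⟩ : Coalgebra.Repr ℂ h (Fin n))
    simp only [hh_one, one_smul] at key
    simp only [LinearMap.comp_apply, hθ a b _ _ h₁ h₂ hr, map_sum, hμ, LinearMap.id_apply,
      mul_assoc]
    rw [← TensorProduct.tmul_sum, ← Finset.mul_sum, key, mul_one]
  have hTθ : T = θ ∘ₗ μ := by
    refine TensorProduct.ext_threefold' fun x y z ↦ ?_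
    have key := congr((((LinearMap.mulLeft ℂ z ∘ₗ HopfAlgebra.antipode ℂ).lTensor H).lTensor H)
      (x ⊗ₜ[ℂ] $(comul_mul_tmul_one_of_mul_eq_counit_smul hh_right y)))
    rw [LinearMap.comp_apply, hμ, hT x y z _ _ h₁ h₂ hr, hθ x (z * y) _ _ h₁ h₂ hr]
    simpa [hr, Finset.sum_mul, TensorProduct.tmul_sum, HopfAlgebra.antipode_mul_antidistrib, hS,
      mul_assoc] using key
  have hsub : {u : H ⊗[ℂ] (H ⊗[ℂ] H) | T u = u} ⊆ Set.range θ := by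
    rintro u hu
    exact ⟨μ u, by rw [← LinearMap.comp_apply, ← hTθ]; exact hu⟩
  refine ⟨Function.LeftInverse.injective (g := μ) (LinearMap.congr_fun hμθ), hsub, ?_⟩
  calc
    _ ≤ Module.finrank ℂ (LinearMap.range θ) :=
      Submodule.finrank_mono (Submodule.span_le.mpr hsub)
    _ ≤ Module.finrank ℂ (H ⊗[ℂ] H) := LinearMap.finrank_range_le θ
    _ = _ := by rw [Module.finrank_tensorProduct, sq]
end

section
/- Let H be a finite-dimensional Hopf algebra over ℂ with involutive antipode (S∘S = id), let h ∈ H be a normalized two-sided integral, let φ ∈ H* be a normalized two-sided integral functional with φ(h) = 1/dim_ℂ H, and let δ = √(dim_ℂ H). Then the vector space H* ⊗ H is a Hopf algebra over ℂ with multiplication (f⊗x)(g⊗y) = gf ⊗ yx, unit ε ⊗ 1, comultiplication Δ(f⊗x) = δ² φ₂(x₂) φ₄(S(h₂)) (φ₁ f₂ S(φ₃) ⊗ x₁) ⊗ (f₁ ⊗ h₁), counit f⊗x ↦ f(1)ε(x), and antipode f⊗x ↦ δ² φ₄(x) φ₂(h₂) (φ₁ S(f) S(φ₃) ⊗ h₁),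 where φ₁ ⊗ φ₂ ⊗ ⋯ denotes the iterated coproduct of φ in the dual Hopf algebra H* and h₁ ⊗ h₂ that of h in H. -/
open TensorProduct

variable (H : Type*) [Ring H] [HopfAlgebra ℂ H]

/-- The convolution product on the dual of a coalgebra: `(conv f g)(x) = f(x₁)g(x₂)`; this is
the multiplication of the dual Hopf algebra `H*`. -/
noncomputable def conv (f g : Module.Dual ℂ H) : Module.Dual ℂ H :=
  (TensorProduct.lid ℂ ℂ).toLinearMap ∘ₗ TensorProduct.map f g ∘ₗ Coalgebra.comul (R := ℂ)

/-- The antipode of the dual Hopf algebra `H*`: `S(f) = f ∘ S`. -/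
noncomputable def dualAntipode (f : Module.Dual ℂ H) : Module.Dual ℂ H :=
  f ∘ₗ HopfAlgebra.antipode (R := ℂ)

namespace HopfAlgebra

open Coalgebra LinearMap TensorProduct WithConv

section Convolution

variable {R : Type*} [CommRing R]

/-- Pre-composition with a coalgebra morphism and post-composition with an algebra morphism,
as a homomorphism of convolution monoids. -/
noncomputable def convMap {B B' C C' : Type*} [Ring B] [Algebra R B] [Ring B'] [Algebra R B']
    [AddCommGroup C] [Module R C] [Coalgebra R C] [AddCommGroup C'] [Module R C'] [Coalgebra R C']
    (k : B →ₐ[R] B') (g : C' →ₗc[R] C) :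
    WithConv (C →ₗ[R] B) →* WithConv (C' →ₗ[R] B') where
  toFun X := toConv (k.toLinearMap ∘ₗ X.ofConv ∘ₗ g.toLinearMap)
  map_one' := by ext; simp
  map_mul' X Y := by
    rw [convMul_comp_coalgHom_distrib, algHom_comp_convMul_distrib]

@[simp]
lemma convMap_apply {B B' C C' : Type*} [Ring B] [Algebra R B] [Ring B'] [Algebra R B']
    [AddCommGroup C] [Module R C] [Coalgebra R C] [AddCommGroup C'] [Module R C'] [Coalgebra R C']
    (k : B →ₐ[R] B') (g : C' →ₗc[R] C) (X : WithConv (C →ₗ[R] B)) (c : C') :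
    convMap k g X c = k (X (g c)) := rfl

lemma sum_counit_right_smul {C ι : Type*} [AddCommGroup C] [Module R C] [Coalgebra R C] {c : C}
    (𝓡 : Coalgebra.Repr R c ι) :
    ∑ i ∈ 𝓡.index, counit (R := R) (𝓡.right i) • 𝓡.left i = c := by
  simpa only [map_sum, TensorProduct.rid_tmul, one_smul] using
    congr(TensorProduct.rid R C $(sum_tmul_counit_eq 𝓡))

variable {B C D : Type*} [Ring B] [Algebra R B] [Ring C] [Bialgebra R C]
  [Ring D] [Bialgebra R D]

variable (R C D) in
/-- The coalgebra morphism `c ⊗ d ↦ ε(d) c`. -/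
noncomputable def tensorFst : C ⊗[R] D →ₗc[R] C :=
  (Coalgebra.TensorProduct.rid R R C).toCoalgHom.comp
    (Coalgebra.TensorProduct.map (.id R C) (counitCoalgHom R D))

@[simp]
lemma tensorFst_tmul (c : C) (d : D) :
    tensorFst R C D (c ⊗ₜ d) = counit (R := R) d • c := rfl

lemma toConv_comp_tensorFst_mul_apply (f : C →ₗ[R] B) (Y : WithConv (C ⊗[R] D →ₗ[R] B))
    (c : C) (d : D) :
    (toConv (f ∘ₗ (tensorFst R C D).toLinearMap) * Y) (c ⊗ₜ d) =
      (toConv f * toConv (Y.ofConv ∘ₗ (TensorProduct.mk R C D).flip d)) c := by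
  rw [((ℛ R c).tmul (ℛ R d)).convMul_apply, (ℛ R c).convMul_apply]
  simp only [Coalgebra.Repr.tmul, Finset.sum_product]
  refine Finset.sum_congr rfl fun i _ => ?_
  conv_rhs => rw [← sum_counit_smul (ℛ R d)]
  simp [Finset.mul_sum]

lemma mul_toConv_comp_tensorFst_apply (f : C →ₗ[R] B) (Y : WithConv (C ⊗[R] D →ₗ[R] B))
    (c : C) (d : D) :
    (Y * toConv (f ∘ₗ (tensorFst R C D).toLinearMap)) (c ⊗ₜ d) =
      (toConv (Y.ofConv ∘ₗ (TensorProduct.mk R C D).flip d) * toConv f) c := by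
  rw [((ℛ R c).tmul (ℛ R d)).convMul_apply, (ℛ R c).convMul_apply]
  simp only [Coalgebra.Repr.tmul, Finset.sum_product]
  refine Finset.sum_congr rfl fun i _ => ?_
  conv_rhs => rw [← sum_counit_right_smul (ℛ R d)]
  simp [Finset.sum_mul]

end Convolution

section Antipode

variable {R A B : Type*} [CommRing R] [Ring A] [HopfAlgebra R A] [Ring B] [Algebra R B]

lemma algHom_mul_antipode (k : A →ₐ[R] B) :
    toConv k.toLinearMap * toConv (k.toLinearMap ∘ₗ antipode R) = 1 := by
  ext a
  rw [(ℛ R a).convMul_apply]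
  simpa using congr(k $(sum_mul_antipode_eq_algebraMap_counit (ℛ R a)))

lemma antipode_mul_algHom (k : A →ₐ[R] B) :
    toConv (k.toLinearMap ∘ₗ antipode R) * toConv k.toLinearMap = 1 := by
  ext a
  rw [(ℛ R a).convMul_apply]
  simpa using congr(k $(sum_antipode_mul_eq_algebraMap_counit (ℛ R a)))

variable (R A) in
/-- The algebra morphism `a ↦ a ⊗ 1`. -/
noncomputable abbrev inl : A →ₐ[R] A ⊗[R] A := Algebra.TensorProduct.includeLeft

variable (R A) in
/-- The algebra morphism `a ↦ 1 ⊗ a`. -/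
noncomputable abbrev inr : A →ₐ[R] A ⊗[R] A := Algebra.TensorProduct.includeRight

lemma toConv_inl_mul_inr :
    toConv (inl R A).toLinearMap * toConv (inr R A).toLinearMap = toConv comul := by
  ext a
  rw [(ℛ R a).convMul_apply]
  simp [← (ℛ R a).eq]

lemma toConv_comul_comp_antipode :
    toConv (comul (R := R) ∘ₗ antipode R (A := A)) =
      toConv ((inr R A).toLinearMap ∘ₗ antipode R) *
        toConv ((inl R A).toLinearMap ∘ₗ antipode R) := by
  refine left_inv_eq_right_inv (antipode_mul_algHom (Bialgebra.comulAlgHom R A)) ?_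
  have : toConv (Bialgebra.comulAlgHom R A).toLinearMap = toConv comul := rfl
  rw [this, ← toConv_inl_mul_inr, mul_assoc, ← mul_assoc (toConv (inr R A).toLinearMap),
    algHom_mul_antipode, one_mul, algHom_mul_antipode]

/-- The antipode is an anti-morphism of coalgebras. -/
lemma comul_antipode (a : A) :
    comul (R := R) (antipode R a) =
      TensorProduct.comm R A A (TensorProduct.map (antipode R) (antipode R) (comul a)) := by
  have := congr($(toConv_comul_comp_antipode (R := R) (A := A)) a)
  rw [(ℛ R a).convMul_apply] at this
  simpa [← (ℛ R a).eq] using this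

/-- A representation of `Δ(S a)` obtained from one of `Δ a`. -/
noncomputable def reprAntipode {a : A} {ι : Type*} (𝓡 : Coalgebra.Repr R a ι) :
    Coalgebra.Repr R (antipode R a) ι where
  index := 𝓡.index
  left i := antipode R (𝓡.right i)
  right i := antipode R (𝓡.left i)
  eq := by simp [comul_antipode, ← 𝓡.eq]

variable (hS : ∀ a : A, antipode R (antipode R a) = a)
include hS

lemma sum_right_mul_antipode_left {a : A} {ι : Type*} (𝓡 : Coalgebra.Repr R a ι) :
    ∑ i ∈ 𝓡.index, 𝓡.right i * antipode R (𝓡.left i) = algebraMap R A (counit a) := by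
  simpa [reprAntipode, hS] using sum_antipode_mul_eq_algebraMap_counit (reprAntipode 𝓡)

lemma sum_antipode_right_mul_left {a : A} {ι : Type*} (𝓡 : Coalgebra.Repr R a ι) :
    ∑ i ∈ 𝓡.index, antipode R (𝓡.right i) * 𝓡.left i = algebraMap R A (counit a) := by
  simpa [reprAntipode, hS] using sum_mul_antipode_eq_algebraMap_counit (reprAntipode 𝓡)

end Antipode

section DoubleComul

variable {R A : Type*} [CommRing R] [Ring A] [HopfAlgebra R A]

variable (R A) in
/-- The coalgebra morphism `a ⊗ b ↦ b * a`. -/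
noncomputable def mulOp : A ⊗[R] A →ₗc[R] A :=
  (Bialgebra.mulCoalgHom R A).comp
    (Bialgebra.TensorProduct.comm R A A : A ⊗[R] A →ₗc[R] A ⊗[R] A)

@[simp]
lemma mulOp_tmul (a b : A) : mulOp R A (a ⊗ₜ b) = b * a := rfl

variable (R A) in
/-- The element `a ⊗ b ↦ ε(b) (1 ⊗ a)` of the convolution algebra. -/
noncomputable def twist : WithConv (A ⊗[R] A →ₗ[R] A ⊗[R] A) :=
  convMap (inr R A) (tensorFst R A A) (toConv .id)

variable (R A) in
/-- The convolution inverse `a ⊗ b ↦ ε(b) (1 ⊗ S a)` of `twist`. -/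
noncomputable def twistInv : WithConv (A ⊗[R] A →ₗ[R] A ⊗[R] A) :=
  convMap (inr R A) (tensorFst R A A) (toConv (antipode R))

@[simp]
lemma twist_tmul (a b : A) : twist R A (a ⊗ₜ b) = counit (R := R) b • (1 ⊗ₜ a) := by
  simp [twist]

lemma twistInv_mul_twist : twistInv R A * twist R A = 1 := by
  rw [twist, twistInv, ← map_mul, antipode_mul_id, map_one]

lemma twist_mul_twistInv : twist R A * twistInv R A = 1 := by
  rw [twist, twistInv, ← map_mul, id_mul_antipode, map_one]

/-- The comultiplication of the dual of the Drinfeld double of `A`, on the convolution algebra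
`End A`: it maps `F` to `a ⊗ b ↦ (1 ⊗ a₁) Δ(F(b a₂)) (1 ⊗ S(a₃))`. -/
noncomputable def doubleComul :
    WithConv (A →ₗ[R] A) →* WithConv (A ⊗[R] A →ₗ[R] A ⊗[R] A) where
  toFun F := twist R A * convMap (Bialgebra.comulAlgHom R A) (mulOp R A) F * twistInv R A
  map_one' := by rw [map_one, mul_one, twist_mul_twistInv]
  map_mul' F G := by
    simp only [map_mul, mul_assoc]
    rw [← mul_assoc (twistInv R A), twistInv_mul_twist, one_mul]

lemma doubleComul_apply (F : WithConv (A →ₗ[R] A)) :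
    doubleComul F =
      twist R A * convMap (Bialgebra.comulAlgHom R A) (mulOp R A) F * twistInv R A := rfl

lemma doubleComul_add (F G : WithConv (A →ₗ[R] A)) :
    doubleComul (F + G) = doubleComul F + doubleComul G := by
  have : convMap (Bialgebra.comulAlgHom R A) (mulOp R A) (F + G) =
      convMap (Bialgebra.comulAlgHom R A) (mulOp R A) F +
        convMap (Bialgebra.comulAlgHom R A) (mulOp R A) G := by
    ext; simp
  simp only [doubleComul_apply, this, mul_add, add_mul]

lemma doubleComul_zero : doubleComul (0 : WithConv (A →ₗ[R] A)) = 0 := by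
  simpa using doubleComul_add (0 : WithConv (A →ₗ[R] A)) 0

lemma doubleComul_tmul (F : WithConv (A →ₗ[R] A)) (a b : A) :
    doubleComul F (a ⊗ₜ b) =
      (toConv (inr R A).toLinearMap * toConv (comul ∘ₗ F.ofConv ∘ₗ mulLeft R b) *
        toConv ((inr R A).toLinearMap ∘ₗ antipode R)) a := by
  have h : toConv ((convMap (Bialgebra.comulAlgHom R A) (mulOp R A) F * twistInv R A).ofConv ∘ₗ
      (TensorProduct.mk R A A).flip b) = toConv (comul ∘ₗ F.ofConv ∘ₗ mulLeft R b) *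
        toConv ((inr R A).toLinearMap ∘ₗ antipode R) := by
    ext c
    exact mul_toConv_comp_tensorFst_apply ((inr R A).toLinearMap ∘ₗ antipode R)
      (convMap (Bialgebra.comulAlgHom R A) (mulOp R A) F) c b
  rw [doubleComul_apply, mul_assoc, mul_assoc, ← h]
  exact toConv_comp_tensorFst_mul_apply _ _ a b

lemma doubleComul_one_tmul (F : WithConv (A →ₗ[R] A)) (b : A) :
    doubleComul F (1 ⊗ₜ b) = comul (R := R) (F b) := by
  simp [doubleComul_tmul, convMul_apply, Algebra.TensorProduct.one_def]
  rw [← Algebra.TensorProduct.one_def, one_mul, mul_one]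

lemma rid_map_counit_doubleComul (F : WithConv (A →ₗ[R] A)) (a : A) :
    TensorProduct.rid R A (TensorProduct.map .id counit (doubleComul F (a ⊗ₜ 1))) = F a := by
  let k : A ⊗[R] A →ₐ[R] A := (Algebra.TensorProduct.rid R R A).toAlgHom.comp
    (Algebra.TensorProduct.map (.id R A) (Bialgebra.counitAlgHom R A))
  have hk (X : A →ₗ[R] A ⊗[R] A) (b : A) : convMap k (.id R A) (toConv X) b =
    TensorProduct.rid R A (TensorProduct.map .id counit (X b)) := rfl
  have h₁ : convMap k (.id R A) (toConv (inr R A).toLinearMap) = 1 := by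
    ext b; simp [hk, Algebra.algebraMap_eq_smul_one]
  have h₂ : convMap k (.id R A) (toConv ((inr R A).toLinearMap ∘ₗ antipode R)) = 1 := by
    ext b; simp [hk, Algebra.algebraMap_eq_smul_one]
  have h₃ : convMap k (.id R A) (toConv (comul ∘ₗ F.ofConv ∘ₗ mulLeft R 1)) = F := by
    ext b; simp only [hk]
    have := congr(TensorProduct.rid R A $(lTensor_counit_comul (R := R) (F b)))
    simpa [LinearMap.lTensor] using this
  rw [doubleComul_tmul]
  refine (hk _ a).symm.trans ?_
  rw [toConv_ofConv, map_mul, map_mul, h₁, h₂, h₃, one_mul, mul_one]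

end DoubleComul

section Coassoc

lemma map_conj_mul_map_conj {L M N : Type*} [Monoid L] [Monoid M] [Monoid N]
    {T : M →* N} {l : L →* M} {r : L →* N} {x x' y : L} {i i' : M} {j j' : N}
    (h : x * x' = 1) (h' : x' * x = 1) (hi : i' * i = 1) (hj : j * j' = 1)
    (hx : T (i * l x) = j * r x) (hy : T (l y) = r y) :
    T (i * l (x * y * x') * i') = j * r (x * y * x') * j' := by
  have hx' : T (l x' * i') = r x' * j' := by
    refine left_inv_eq_right_inv (a := T (i * l x)) ?_ ?_
    · rw [← map_mul, mul_assoc, ← mul_assoc i', hi, one_mul, ← map_mul, h', map_one, map_one]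
    · rw [hx, mul_assoc, ← mul_assoc (r x), ← map_mul, h, map_one, one_mul, hj]
  calc _ = T (i * l x) * T (l y) * T (l x' * i') := by simp only [map_mul, mul_assoc]
    _ = _ := by rw [hx, hy, hx']; simp only [map_mul, mul_assoc]

variable {R A : Type*} [CommRing R] [Ring A] [HopfAlgebra R A]

variable (R A) in
/-- Reassociation of both source and target, on convolution algebras. -/
noncomputable def convAssoc :
    WithConv ((A ⊗[R] A) ⊗[R] A →ₗ[R] (A ⊗[R] A) ⊗[R] A) →*
      WithConv (A ⊗[R] (A ⊗[R] A) →ₗ[R] A ⊗[R] (A ⊗[R] A)) :=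
  convMap (Algebra.TensorProduct.assoc R R R A A A).toAlgHom
    (Coalgebra.TensorProduct.assoc R R A A A).symm.toCoalgHom

variable (R A) in
/-- The middle factor of `(doubleComul ⊗ id)`. -/
noncomputable def convComulLeft :
    WithConv (A ⊗[R] A →ₗ[R] A ⊗[R] A) →*
      WithConv ((A ⊗[R] A) ⊗[R] A →ₗ[R] (A ⊗[R] A) ⊗[R] A) :=
  convMap (Algebra.TensorProduct.map (Bialgebra.comulAlgHom R A) (.id R A))
    (Coalgebra.TensorProduct.map (mulOp R A) (.id R A))

variable (R A) in
/-- The middle factor of `(id ⊗ doubleComul)`. -/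
noncomputable def convComulRight :
    WithConv (A ⊗[R] A →ₗ[R] A ⊗[R] A) →*
      WithConv (A ⊗[R] (A ⊗[R] A) →ₗ[R] A ⊗[R] (A ⊗[R] A)) :=
  convMap (Algebra.TensorProduct.map (.id R A) (Bialgebra.comulAlgHom R A))
    (Coalgebra.TensorProduct.map (.id R A) (mulOp R A))

variable (R A) in
/-- The map `twist ⊗ 1`, where `1` is the convolution unit. -/
noncomputable def twistLeft : WithConv ((A ⊗[R] A) ⊗[R] A →ₗ[R] (A ⊗[R] A) ⊗[R] A) :=
  toConv (TensorProduct.map (twist R A).ofConv (1 : WithConv (A →ₗ[R] A)).ofConv)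

variable (R A) in
/-- The map `1 ⊗ twist`, where `1` is the convolution unit. -/
noncomputable def twistRight : WithConv (A ⊗[R] (A ⊗[R] A) →ₗ[R] A ⊗[R] (A ⊗[R] A)) :=
  toConv (TensorProduct.map (1 : WithConv (A →ₗ[R] A)).ofConv (twist R A).ofConv)

variable (R A) in
/-- The convolution inverse `twistInv ⊗ 1` of `twistLeft`. -/
noncomputable def twistInvLeft : WithConv ((A ⊗[R] A) ⊗[R] A →ₗ[R] (A ⊗[R] A) ⊗[R] A) :=
  toConv (TensorProduct.map (twistInv R A).ofConv (1 : WithConv (A →ₗ[R] A)).ofConv)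

variable (R A) in
/-- The convolution inverse `1 ⊗ twistInv` of `twistRight`. -/
noncomputable def twistInvRight : WithConv (A ⊗[R] (A ⊗[R] A) →ₗ[R] A ⊗[R] (A ⊗[R] A)) :=
  toConv (TensorProduct.map (1 : WithConv (A →ₗ[R] A)).ofConv (twistInv R A).ofConv)

lemma toConv_map_one_one {B C : Type*} [Ring B] [HopfAlgebra R B] [Ring C] [HopfAlgebra R C] :
    toConv (TensorProduct.map (1 : WithConv (B →ₗ[R] B)).ofConv
      (1 : WithConv (C →ₗ[R] C)).ofConv) = 1 := by
  ext b c
  simp [Algebra.algebraMap_eq_smul_one,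
    Algebra.TensorProduct.one_def, TensorProduct.smul_tmul, smul_smul, mul_comm]

lemma twistInvLeft_mul_twistLeft : twistInvLeft R A * twistLeft R A = 1 := by
  rw [twistInvLeft, twistLeft, TensorProduct.map_convMul_map, toConv_ofConv, toConv_ofConv,
    toConv_ofConv, twistInv_mul_twist, one_mul, toConv_map_one_one]

lemma twistRight_mul_twistInvRight : twistRight R A * twistInvRight R A = 1 := by
  rw [twistInvRight, twistRight, TensorProduct.map_convMul_map, toConv_ofConv, toConv_ofConv,
    toConv_ofConv, twist_mul_twistInv, one_mul, toConv_map_one_one]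

lemma convAssoc_convComulLeft (F : WithConv (A →ₗ[R] A)) :
    convAssoc R A (convComulLeft R A (convMap (Bialgebra.comulAlgHom R A) (mulOp R A) F)) =
      convComulRight R A (convMap (Bialgebra.comulAlgHom R A) (mulOp R A) F) := by
  ext a b c
  change TensorProduct.assoc R A A A (rTensor A comul (comul (F (c * (b * a))))) =
    lTensor A comul (comul (F (c * b * a)))
  rw [mul_assoc, coassoc_apply]

lemma convAssoc_twist :
    convAssoc R A (twistLeft R A * convComulLeft R A (twist R A)) =
      twistRight R A * convComulRight R A (twist R A) := by
  have h₁ : convAssoc R A (twistLeft R A) = convMap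
      ((Algebra.TensorProduct.assoc R R R A A A).toAlgHom.comp
        (Algebra.TensorProduct.includeLeft.comp (inr R A)))
        (tensorFst R A (A ⊗[R] A)) (toConv .id) := by
    ext a b c
    simp [convAssoc, twistLeft, Algebra.algebraMap_eq_smul_one, ← TensorProduct.smul_tmul',
      smul_smul]
  have h₂ : convComulRight R A (twist R A) =
      convMap ((Algebra.TensorProduct.includeRight : A ⊗[R] A →ₐ[R] A ⊗[R] (A ⊗[R] A)).comp
        (Bialgebra.comulAlgHom R A)) (tensorFst R A (A ⊗[R] A)) (toConv .id) := by
    ext a b c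
    simp [convComulRight]
  rw [map_mul, h₁, h₂]
  ext a b c
  refine (toConv_comp_tensorFst_mul_apply _ _ a (b ⊗ₜ c)).trans ?_
  refine Eq.trans ?_ (mul_toConv_comp_tensorFst_apply _ _ a (b ⊗ₜ c)).symm
  rw [(ℛ R a).convMul_apply, (ℛ R a).convMul_apply]
  trans counit (R := R) c • ((1 : A) ⊗ₜ[R] ((1 ⊗ₜ b) * comul (R := R) a))
  · rw [← (ℛ R a).eq]
    simp [convAssoc, convComulLeft, Algebra.TensorProduct.one_def, Finset.mul_sum,
      TensorProduct.tmul_sum, Finset.smul_sum]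
    refine Finset.sum_congr rfl fun i _ => ?_
    rw [mul_smul_comm]
    simp
  · conv_lhs => rw [← sum_counit_smul (ℛ R a)]
    simp [twistRight, Finset.mul_sum, TensorProduct.tmul_sum, Finset.smul_sum,
      Algebra.algebraMap_eq_smul_one, ← TensorProduct.smul_tmul']
    refine Finset.sum_congr rfl fun i _ => ?_
    rw [smul_mul_assoc, smul_mul_assoc]
    simp

lemma doubleComul_coassoc (F : WithConv (A →ₗ[R] A)) :
    convAssoc R A (twistLeft R A * convComulLeft R A (doubleComul F) * twistInvLeft R A) =
      twistRight R A * convComulRight R A (doubleComul F) * twistInvRight R A :=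
  map_conj_mul_map_conj twist_mul_twistInv twistInv_mul_twist twistInvLeft_mul_twistLeft
    twistRight_mul_twistInvRight convAssoc_twist (convAssoc_convComulLeft F)

end Coassoc

section DoubleAntipode

variable {R A : Type*} [CommRing R] [Ring A] [HopfAlgebra R A]

/-- The antipode of the dual of the Drinfeld double of `A`, on the convolution algebra `End A`:
it maps `F` to `a ↦ S(a₁) S(F(S(a₂))) a₃`. -/
noncomputable def doubleAntipode (F : WithConv (A →ₗ[R] A)) : WithConv (A →ₗ[R] A) :=
  toConv (antipode R) * toConv (antipode R ∘ₗ F.ofConv ∘ₗ antipode R) * toConv .id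

lemma doubleAntipode_add (F G : WithConv (A →ₗ[R] A)) :
    doubleAntipode (F + G) = doubleAntipode F + doubleAntipode G := by
  simp only [doubleAntipode, ofConv_add, add_comp, comp_add, toConv_add, mul_add, add_mul]

lemma doubleAntipode_zero : doubleAntipode (0 : WithConv (A →ₗ[R] A)) = 0 := by
  simpa using doubleAntipode_add (0 : WithConv (A →ₗ[R] A)) 0

lemma toConv_inl_mul_toConv_inl_antipode_mul_inr_antipode :
    toConv (inl R A).toLinearMap * (toConv ((inl R A).toLinearMap ∘ₗ antipode R) *
      toConv ((inr R A).toLinearMap ∘ₗ antipode R)) =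
      toConv ((inr R A).toLinearMap ∘ₗ antipode R) := by
  rw [← mul_assoc, algHom_mul_antipode, one_mul]

lemma toConv_inl_antipode_mul_inl_mul_inr :
    toConv ((inl R A).toLinearMap ∘ₗ antipode R) *
      (toConv (inl R A).toLinearMap * toConv (inr R A).toLinearMap) =
      toConv (inr R A).toLinearMap := by
  rw [← mul_assoc, antipode_mul_algHom, one_mul]

variable (hS : ∀ a : A, antipode R (antipode R a) = a)
include hS

lemma mul_map_antipode_comm_comul (a : A) :
    mul' R A (TensorProduct.map .id (antipode R) (TensorProduct.comm R A A (comul a))) =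
      algebraMap R A (counit a) := by
  rw [← sum_right_mul_antipode_left hS (ℛ R a), ← (ℛ R a).eq]
  simp

lemma mul_map_antipode_id_comm_comul (a : A) :
    mul' R A (TensorProduct.map (antipode R) .id (TensorProduct.comm R A A (comul a))) =
      algebraMap R A (counit a) := by
  rw [← sum_antipode_right_mul_left hS (ℛ R a), ← (ℛ R a).eq]
  simp

lemma sum_mul_doubleAntipode {F : WithConv (A →ₗ[R] A)} {ι : Type*} (s : Finset ι)
    (u v : ι → A →ₗ[R] A)
    (hF : doubleComul F = toConv (∑ i ∈ s, TensorProduct.map (u i) (v i))) :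
    ∑ i ∈ s, toConv (v i) * doubleAntipode (toConv (u i)) = counit (R := R) (F 1) • 1 := by
  let κ : A ⊗[R] A →ₗ[R] A :=
    mul' R A ∘ₗ TensorProduct.map .id (antipode R) ∘ₗ (TensorProduct.comm R A A).toLinearMap
  have hκ (x : A) (w : A ⊗[R] A) : κ (inr R A x * w) = x * κ w := by
    induction w with
    | zero => simp
    | tmul y z => simp [κ, mul_assoc]
    | add y z hy hz => rw [mul_add, map_add, map_add, hy, hz, mul_add]
  have hκ' (x : A) : κ (comul x) = algebraMap R A (counit x) := mul_map_antipode_comm_comul hS x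
  have h₁ (b c : A) : ∑ i ∈ s, v i b *
      (toConv (antipode R) * toConv (antipode R ∘ₗ u i ∘ₗ antipode R)).ofConv c =
      ∑ q ∈ (ℛ R c).index, counit (R := R) (F (b * antipode R ((ℛ R c).left q))) •
        antipode R ((ℛ R c).right q) := by
    have h₂ (a : A) : (toConv (inr R A).toLinearMap * toConv (comul ∘ₗ F.ofConv ∘ₗ mulLeft R b) *
        toConv ((inr R A).toLinearMap ∘ₗ antipode R)).ofConv a = ∑ i ∈ s, u i a ⊗ₜ v i b := by
      rw [← doubleComul_tmul, hF]
      simp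
    trans κ ((toConv (inr R A).toLinearMap * toConv (comul ∘ₗ F.ofConv ∘ₗ mulLeft R b) *
      toConv ((inr R A).toLinearMap ∘ₗ antipode R) * toConv (inr R A).toLinearMap).ofConv
        (antipode R c))
    · rw [(reprAntipode (ℛ R c)).convMul_apply]
      simp only [h₂, (ℛ R c).convMul_apply, map_sum, Finset.mul_sum, Finset.sum_mul]
      rw [Finset.sum_comm]
      simp [κ, reprAntipode, mul_assoc]
    · rw [mul_assoc, antipode_mul_algHom, mul_one, (reprAntipode (ℛ R c)).convMul_apply, map_sum]
      refine Finset.sum_congr rfl fun q _ => ?_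
      refine (hκ _ _).trans ?_
      simp [reprAntipode, hκ', Algebra.algebraMap_eq_smul_one]
  have h₃ : ∑ i ∈ s, toConv (v i) *
      (toConv (antipode R) * toConv (antipode R ∘ₗ u i ∘ₗ antipode R)) =
      counit (R := R) (F 1) • toConv (antipode R) := by
    ext a
    have := congr(TensorProduct.lid R A (TensorProduct.map (counit ∘ₗ F.ofConv) .id
      ($(toConv_inl_mul_toConv_inl_antipode_mul_inr_antipode (R := R) (A := A)) a)))
    simp only [(ℛ R a).convMul_apply, (ℛ R _).convMul_apply, map_sum, Finset.mul_sum] at this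
    simp [(ℛ R a).convMul_apply, -convMul_apply]
    rw [Finset.sum_comm]
    simp only [h₁]
    simpa using this
  simp only [doubleAntipode, ← mul_assoc, ← Finset.sum_mul]
  simp only [mul_assoc, h₃, smul_mul_assoc, antipode_mul_id]

lemma sum_doubleAntipode_mul {F : WithConv (A →ₗ[R] A)} {ι : Type*} (s : Finset ι)
    (u v : ι → A →ₗ[R] A)
    (hF : doubleComul F = toConv (∑ i ∈ s, TensorProduct.map (u i) (v i))) :
    ∑ i ∈ s, doubleAntipode (toConv (v i)) * toConv (u i) = counit (R := R) (F 1) • 1 := by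
  let κ : A ⊗[R] A →ₗ[R] A :=
    mul' R A ∘ₗ TensorProduct.map (antipode R) .id ∘ₗ (TensorProduct.comm R A A).toLinearMap
  have hκ (x : A) (w : A ⊗[R] A) : κ (w * inr R A (antipode R x)) = x * κ w := by
    induction w with
    | zero => simp
    | tmul y z => simp [κ, mul_assoc, antipode_mul_antidistrib, hS]
    | add y z hy hz => rw [add_mul, map_add, map_add, hy, hz, mul_add]
  have hκ' (x : A) : κ (comul x) = algebraMap R A (counit x) :=
    mul_map_antipode_id_comm_comul hS x
  have h₁ (b c : A) : ∑ i ∈ s, antipode R (v i b) * (toConv LinearMap.id * toConv (u i)).ofConv c =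
      ∑ q ∈ (ℛ R c).index, counit (R := R) (F (b * (ℛ R c).left q)) • (ℛ R c).right q := by
    have h₂ (a : A) : (toConv (inr R A).toLinearMap * toConv (comul ∘ₗ F.ofConv ∘ₗ mulLeft R b) *
        toConv ((inr R A).toLinearMap ∘ₗ antipode R)).ofConv a = ∑ i ∈ s, u i a ⊗ₜ v i b := by
      rw [← doubleComul_tmul, hF]
      simp
    trans κ ((toConv ((inr R A).toLinearMap ∘ₗ antipode R) * (toConv (inr R A).toLinearMap *
      toConv (comul ∘ₗ F.ofConv ∘ₗ mulLeft R b) *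
      toConv ((inr R A).toLinearMap ∘ₗ antipode R))).ofConv c)
    · rw [(ℛ R c).convMul_apply]
      simp only [h₂, (ℛ R c).convMul_apply, map_sum, Finset.mul_sum]
      rw [Finset.sum_comm]
      simp [κ, mul_assoc, antipode_mul_antidistrib, hS]
    · rw [← mul_assoc, ← mul_assoc, antipode_mul_algHom, one_mul, (ℛ R c).convMul_apply, map_sum]
      refine Finset.sum_congr rfl fun q _ => ?_
      refine (hκ _ _).trans ?_
      simp [hκ', Algebra.algebraMap_eq_smul_one]
  have h₃ : ∑ i ∈ s, toConv (antipode R ∘ₗ v i ∘ₗ antipode R) * (toConv LinearMap.id * toConv (u i)) =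
      counit (R := R) (F 1) • toConv .id := by
    ext a
    have := congr(TensorProduct.lid R A (TensorProduct.map (counit ∘ₗ F.ofConv) .id
      ($(toConv_inl_antipode_mul_inl_mul_inr (R := R) (A := A)) a)))
    simp only [(ℛ R a).convMul_apply, (ℛ R _).convMul_apply, map_sum, Finset.mul_sum] at this
    simp [(ℛ R a).convMul_apply, -convMul_apply]
    rw [Finset.sum_comm]
    simp only [h₁]
    simpa using this
  simp only [doubleAntipode, mul_assoc, ← Finset.mul_sum]
  simp only [h₃, mul_smul_comm, antipode_mul_id]

end DoubleAntipode

section Fourier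

variable {R A : Type*} [CommRing R] [Ring A] [HopfAlgebra R A] {h : A}

lemma inr_mul_comul_integral (hl : ∀ x : A, x * h = counit (R := R) x • h) (y : A) :
    inr R A y * comul h = inl R A (antipode R y) * comul h := by
  have key : toConv (inr R A).toLinearMap =
      toConv ((inl R A).toLinearMap ∘ₗ antipode R) * toConv comul := by
    rw [← toConv_inl_mul_inr, ← mul_assoc, antipode_mul_algHom, one_mul]
  have h₁ : inr R A y = ∑ i ∈ (ℛ R y).index,
      inl R A (antipode R ((ℛ R y).left i)) * comul ((ℛ R y).right i) :=
    congr($key y).trans ((ℛ R y).convMul_apply _ _)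
  rw [h₁, Finset.sum_mul]
  conv_rhs => rw [← sum_counit_right_smul (ℛ R y)]
  simp only [mul_assoc, ← Bialgebra.comul_mul, hl, map_sum, map_smul, Finset.sum_mul,
    mul_smul_comm, smul_mul_assoc]

lemma comul_integral_mul_inl (hr : ∀ x : A, h * x = counit (R := R) x • h) (z : A) :
    comul h * inl R A z = comul h * inr R A (antipode R z) := by
  have key : toConv ((inr R A).toLinearMap ∘ₗ antipode R) =
      toConv (comul ∘ₗ antipode R) * toConv (inl R A).toLinearMap := by
    rw [toConv_comul_comp_antipode, mul_assoc, antipode_mul_algHom, mul_one]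
  have h₁ : inr R A (antipode R z) = ∑ i ∈ (ℛ R z).index,
      comul (antipode R ((ℛ R z).left i)) * inl R A ((ℛ R z).right i) :=
    congr($key z).trans ((ℛ R z).convMul_apply _ _)
  rw [h₁, Finset.mul_sum]
  conv_lhs => rw [← sum_counit_smul (ℛ R z)]
  simp only [← mul_assoc, ← Bialgebra.comul_mul, hr, map_sum, map_smul, Finset.mul_sum,
    mul_smul_comm, smul_mul_assoc, counit_antipode]

variable (hS : ∀ a : A, antipode R (antipode R a) = a)
include hS

lemma antipode_integral (hl : ∀ x : A, x * h = counit (R := R) x • h)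
    (h₁ : counit (R := R) h = 1) : antipode R h = h := by
  have h₂ : antipode R h * h = h := by rw [hl, counit_antipode, h₁, one_smul]
  have h₃ := congr(antipode R $h₂)
  rwa [antipode_mul_antidistrib, hS, h₂, eq_comm] at h₃

variable (hl : ∀ x : A, x * h = counit (R := R) x • h)
  (hr : ∀ x : A, h * x = counit (R := R) x • h) (h₁ : counit (R := R) h = 1)
  {φ : A →ₗ[R] R}

include hl h₁ in
lemma rid_map_comp_antipode_comul_integral
    (hφ : ∀ x : A, TensorProduct.lid R A (rTensor A φ (comul x)) = φ x • 1) :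
    TensorProduct.rid R A (TensorProduct.map .id (φ ∘ₗ antipode R) (comul h)) = φ h • 1 := by
  have := congr(antipode R $(hφ (antipode R h)))
  rw [comul_antipode, antipode_integral hS hl h₁, ← (ℛ R h).eq] at this
  rw [← (ℛ R h).eq]
  simpa [hS] using this

include hl hr h₁ in
/-- Inversion formula for the Fourier transform attached to the integrals `h` and `φ`. -/
lemma rid_map_mulLeft_antipode_comul_integral
    (hφ : ∀ x : A, TensorProduct.lid R A (rTensor A φ (comul x)) = φ x • 1) (y : A) :
    TensorProduct.rid R A (TensorProduct.map .id (φ ∘ₗ mulLeft R y ∘ₗ antipode R) (comul h)) =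
      φ h • y := by
  have h₂ := congr($(rid_map_comp_antipode_comul_integral hS hl h₁ hφ) * y)
  have h₃ := congr(TensorProduct.rid R A (TensorProduct.map .id (φ ∘ₗ antipode R)
    $(comul_integral_mul_inl hr y)))
  rw [← (ℛ R h).eq] at h₂ h₃ ⊢
  simp [Finset.sum_mul, antipode_mul_antidistrib, hS] at h₂ h₃ ⊢
  rw [← h₃, h₂]

include hl hr in
lemma rid_map_mulLeft_mulRight_comul_integral
    (hφ : ∀ x : A, TensorProduct.rid R A (lTensor A φ (comul x)) = φ x • 1) (a b : A) :
    TensorProduct.rid R A (TensorProduct.map .id (φ ∘ₗ mulLeft R a ∘ₗ mulRight R b) (comul h)) =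
      φ h • (antipode R a * antipode R b) := by
  have h₂ := congr(antipode R a * $(hφ h) * antipode R b)
  have h₃ := congr(TensorProduct.rid R A (TensorProduct.map .id φ
    ($(inr_mul_comul_integral hl a) * inr R A b)))
  have h₄ := congr(TensorProduct.rid R A (TensorProduct.map .id φ
    (inl R A (antipode R a) * $(comul_integral_mul_inl hr (antipode R b)))))
  rw [← (ℛ R h).eq] at h₂ h₃ h₄ ⊢
  simp [Finset.sum_mul, Finset.mul_sum, hS, mul_assoc] at h₂ h₃ h₄ ⊢
  rw [h₃, ← h₄, h₂]

end Fourier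

section Transfer

variable {A : Type*} [Ring A] [HopfAlgebra ℂ A]

lemma conv_eq (f g : Module.Dual ℂ A) : conv A f g = (toConv f * toConv g).ofConv := by
  ext a
  simp [conv, (ℛ ℂ a).convMul_apply, ← (ℛ ℂ a).eq]

/-- Expansion of a threefold convolution product along a chosen iterated coproduct. -/
lemma convMul_mul_apply {B : Type*} [Ring B] [Algebra ℂ B] (X Y Z : WithConv (A →ₗ[ℂ] B)) (a : A) :
    (X * Y * Z) a = ∑ p ∈ (ℛ ℂ a).index.sigma fun p => (ℛ ℂ ((ℛ ℂ a).left p)).index,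
      X ((ℛ ℂ ((ℛ ℂ a).left p.1)).left p.2) * Y ((ℛ ℂ ((ℛ ℂ a).left p.1)).right p.2) *
        Z ((ℛ ℂ a).right p.1) := by
  simp only [Finset.sum_sigma, (ℛ ℂ a).convMul_apply, (ℛ ℂ _).convMul_apply, Finset.sum_mul]

/-- The linear endomorphism `a ↦ f(a) x` corresponding to `f ⊗ x`, in the convolution algebra. -/
noncomputable def endo (u : Module.Dual ℂ A ⊗[ℂ] A) : WithConv (A →ₗ[ℂ] A) :=
  toConv (dualTensorHom ℂ A A u)

@[simp]
lemma endo_tmul_apply (f : Module.Dual ℂ A) (x a : A) : endo (f ⊗ₜ x) a = f a • x := by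
  simp [endo]

lemma endo_add (u v : Module.Dual ℂ A ⊗[ℂ] A) : endo (u + v) = endo u + endo v := by
  simp [endo]

lemma endo_zero : endo (0 : Module.Dual ℂ A ⊗[ℂ] A) = 0 := by
  simp [endo]

lemma endo_smul (c : ℂ) (u : Module.Dual ℂ A ⊗[ℂ] A) : endo (c • u) = c • endo u := by
  simp [endo]

lemma endo_sum {ι : Type*} (s : Finset ι) (u : ι → Module.Dual ℂ A ⊗[ℂ] A) :
    endo (∑ i ∈ s, u i) = ∑ i ∈ s, endo (u i) := by
  simp [endo]

lemma endo_counit_tmul_one :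
    endo ((counit : Module.Dual ℂ A) ⊗ₜ[ℂ] (1 : A)) = 1 := by
  ext a
  simp [Algebra.algebraMap_eq_smul_one]

/-- The linear endomorphism of `A ⊗ A` corresponding to an element of `(A* ⊗ A) ⊗ (A* ⊗ A)`. -/
noncomputable def endo₂ : (Module.Dual ℂ A ⊗[ℂ] A) ⊗[ℂ] (Module.Dual ℂ A ⊗[ℂ] A) →ₗ[ℂ]
    A ⊗[ℂ] A →ₗ[ℂ] A ⊗[ℂ] A :=
  homTensorHomMap (.id ℂ) A A A A ∘ₗ TensorProduct.map (dualTensorHom ℂ A A) (dualTensorHom ℂ A A)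

@[simp]
lemma endo₂_tmul (u v : Module.Dual ℂ A ⊗[ℂ] A) :
    endo₂ (u ⊗ₜ v) = TensorProduct.map (endo u).ofConv (endo v).ofConv := rfl

/-- The linear endomorphism of `A ⊗ (A ⊗ A)` corresponding to an element of
`(A* ⊗ A) ⊗ ((A* ⊗ A) ⊗ (A* ⊗ A))`. -/
noncomputable def endo₃ : (Module.Dual ℂ A ⊗[ℂ] A) ⊗[ℂ] ((Module.Dual ℂ A ⊗[ℂ] A) ⊗[ℂ]
    (Module.Dual ℂ A ⊗[ℂ] A)) →ₗ[ℂ] A ⊗[ℂ] (A ⊗[ℂ] A) →ₗ[ℂ] A ⊗[ℂ] (A ⊗[ℂ] A) :=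
  homTensorHomMap (.id ℂ) A (A ⊗[ℂ] A) A (A ⊗[ℂ] A) ∘ₗ TensorProduct.map (dualTensorHom ℂ A A) endo₂

@[simp]
lemma endo₃_tmul (u : Module.Dual ℂ A ⊗[ℂ] A)
    (t : (Module.Dual ℂ A ⊗[ℂ] A) ⊗[ℂ] (Module.Dual ℂ A ⊗[ℂ] A)) :
    endo₃ (u ⊗ₜ t) = TensorProduct.map (endo u).ofConv (endo₂ t) := rfl

section Injective

variable [FiniteDimensional ℂ A]

lemma endo_injective : Function.Injective (endo (A := A)) := fun _ _ h =>
  (dualTensorHomEquiv ℂ A A).injective (by simpa [endo] using h)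

lemma dualTensorHom_injective : Function.Injective (dualTensorHom ℂ A A) :=
  (dualTensorHomEquiv ℂ A A).injective

lemma endo₂_injective : Function.Injective (endo₂ (A := A)) := by
  rw [endo₂, ← homTensorHomEquiv_toLinearMap]
  exact (homTensorHomEquiv ℂ A A A A).injective.comp
    (TensorProduct.map_injective_of_flat_flat _ _ dualTensorHom_injective dualTensorHom_injective)

lemma endo₃_injective : Function.Injective (endo₃ (A := A)) := by
  rw [endo₃, ← homTensorHomEquiv_toLinearMap]
  exact (homTensorHomEquiv ℂ A (A ⊗[ℂ] A) A (A ⊗[ℂ] A)).injective.comp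
    (TensorProduct.map_injective_of_flat_flat _ _ dualTensorHom_injective endo₂_injective)

end Injective

section Structure

variable {m : (Module.Dual ℂ A ⊗[ℂ] A) →ₗ[ℂ] (Module.Dual ℂ A ⊗[ℂ] A) →ₗ[ℂ]
    (Module.Dual ℂ A ⊗[ℂ] A)}

lemma endo_mul (hm : ∀ (f g : Module.Dual ℂ A) (x y : A),
      m (f ⊗ₜ[ℂ] x) (g ⊗ₜ[ℂ] y) = conv A g f ⊗ₜ[ℂ] (y * x))
    (u v : Module.Dual ℂ A ⊗[ℂ] A) : endo (m u v) = endo v * endo u := by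
  induction u with
  | zero => simp [endo_zero]
  | add u u' hu hu' => rw [map_add, LinearMap.add_apply, endo_add, endo_add, mul_add, hu, hu']
  | tmul f x =>
    induction v with
    | zero => simp [endo_zero]
    | add v v' hv hv' => rw [map_add, endo_add, endo_add, add_mul, hv, hv']
    | tmul g y =>
      ext a
      rw [hm, endo_tmul_apply, conv_eq, (ℛ ℂ a).convMul_apply, (ℛ ℂ a).convMul_apply]
      simp [Finset.sum_smul, smul_smul, mul_comm]

lemma counit_endo_one {ε : (Module.Dual ℂ A ⊗[ℂ] A) →ₗ[ℂ] ℂ}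
    (hε : ∀ (f : Module.Dual ℂ A) (x : A), ε (f ⊗ₜ[ℂ] x) = f 1 * counit (R := ℂ) x)
    (u : Module.Dual ℂ A ⊗[ℂ] A) : counit (R := ℂ) (endo u 1) = ε u := by
  induction u with
  | zero => simp [endo_zero]
  | add u v hu hv => simp [endo_add, hu, hv]
  | tmul f x => simp [hε]

lemma toConv_map_endo_doubleComul (u v : WithConv (A →ₗ[ℂ] A)) :
    toConv (TensorProduct.map u.ofConv (doubleComul v).ofConv) =
      twistRight ℂ A * convComulRight ℂ A (toConv (TensorProduct.map u.ofConv v.ofConv)) *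
        twistInvRight ℂ A := by
  have : convComulRight ℂ A (toConv (TensorProduct.map u.ofConv v.ofConv)) =
      toConv (TensorProduct.map u.ofConv
        (convMap (Bialgebra.comulAlgHom ℂ A) (mulOp ℂ A) v).ofConv) := by
    ext; simp [convComulRight]
  rw [this, twistRight, twistInvRight, TensorProduct.map_convMul_map,
    TensorProduct.map_convMul_map, doubleComul_apply]
  simp only [one_mul, mul_one]

lemma toConv_map_doubleComul_endo (u v : WithConv (A →ₗ[ℂ] A)) :
    toConv (TensorProduct.map (doubleComul u).ofConv v.ofConv) =
      twistLeft ℂ A * convComulLeft ℂ A (toConv (TensorProduct.map u.ofConv v.ofConv)) *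
        twistInvLeft ℂ A := by
  have : convComulLeft ℂ A (toConv (TensorProduct.map u.ofConv v.ofConv)) =
      toConv (TensorProduct.map
        (convMap (Bialgebra.comulAlgHom ℂ A) (mulOp ℂ A) u).ofConv v.ofConv) := by
    ext; simp [convComulLeft]
  rw [this, twistLeft, twistInvLeft, TensorProduct.map_convMul_map,
    TensorProduct.map_convMul_map, doubleComul_apply]
  simp only [one_mul, mul_one]

lemma convMul_add_mul {C B : Type*} [AddCommGroup C] [Module ℂ C] [Coalgebra ℂ C] [Ring B]
    [Algebra ℂ B] (a x y b : WithConv (C →ₗ[ℂ] B)) :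
    a * (x + y) * b = a * x * b + a * y * b := by
  rw [mul_add, add_mul]

lemma convMul_zero_mul {C B : Type*} [AddCommGroup C] [Module ℂ C] [Coalgebra ℂ C] [Ring B]
    [Algebra ℂ B] (a b : WithConv (C →ₗ[ℂ] B)) : a * 0 * b = 0 := by
  rw [mul_zero, zero_mul]

lemma endo₃_lTensor {Δ : (Module.Dual ℂ A ⊗[ℂ] A) →ₗ[ℂ]
      (Module.Dual ℂ A ⊗[ℂ] A) ⊗[ℂ] (Module.Dual ℂ A ⊗[ℂ] A)}
    (hΔ : ∀ u, toConv (endo₂ (Δ u)) = doubleComul (endo u))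
    (t : (Module.Dual ℂ A ⊗[ℂ] A) ⊗[ℂ] (Module.Dual ℂ A ⊗[ℂ] A)) :
    toConv (endo₃ (lTensor (Module.Dual ℂ A ⊗[ℂ] A) Δ t)) =
      twistRight ℂ A * convComulRight ℂ A (toConv (endo₂ t)) * twistInvRight ℂ A := by
  induction t with
  | zero =>
    have : convComulRight ℂ A 0 = 0 := by ext; simp [convComulRight]
    rw [map_zero, map_zero, map_zero, toConv_zero, toConv_zero, this]
    exact (convMul_zero_mul _ _).symm
  | add t t' ht ht' =>
    have : convComulRight ℂ A (toConv (endo₂ (t + t'))) =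
        convComulRight ℂ A (toConv (endo₂ t)) + convComulRight ℂ A (toConv (endo₂ t')) := by
      ext; simp [convComulRight]
    rw [this, map_add, map_add, toConv_add, ht, ht']
    exact (convMul_add_mul _ _ _ _).symm
  | tmul u v =>
    have : endo₂ (Δ v) = (doubleComul (endo v)).ofConv := congr(($(hΔ v)).ofConv)
    rw [lTensor_tmul, endo₃_tmul, this]
    exact toConv_map_endo_doubleComul _ _

lemma endo₃_assoc_tmul (t : (Module.Dual ℂ A ⊗[ℂ] A) ⊗[ℂ] (Module.Dual ℂ A ⊗[ℂ] A))
    (v : Module.Dual ℂ A ⊗[ℂ] A) :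
    toConv (endo₃ (TensorProduct.assoc ℂ _ _ _ (t ⊗ₜ v))) =
      convAssoc ℂ A (toConv (TensorProduct.map (endo₂ t) (endo v).ofConv)) := by
  induction t with
  | zero => ext; simp [convAssoc]
  | add t t' ht ht' =>
    rw [TensorProduct.add_tmul, map_add, map_add, toConv_add, ht, ht']
    ext; simp [convAssoc, TensorProduct.add_tmul]
  | tmul u u' => ext; simp [convAssoc]

lemma endo₃_rTensor {Δ : (Module.Dual ℂ A ⊗[ℂ] A) →ₗ[ℂ]
      (Module.Dual ℂ A ⊗[ℂ] A) ⊗[ℂ] (Module.Dual ℂ A ⊗[ℂ] A)}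
    (hΔ : ∀ u, toConv (endo₂ (Δ u)) = doubleComul (endo u))
    (t : (Module.Dual ℂ A ⊗[ℂ] A) ⊗[ℂ] (Module.Dual ℂ A ⊗[ℂ] A)) :
    toConv (endo₃ (TensorProduct.assoc ℂ _ _ _ (rTensor (Module.Dual ℂ A ⊗[ℂ] A) Δ t))) =
      convAssoc ℂ A
        (twistLeft ℂ A * convComulLeft ℂ A (toConv (endo₂ t)) * twistInvLeft ℂ A) := by
  induction t with
  | zero =>
    have : convComulLeft ℂ A 0 = 0 := by ext; simp [convComulLeft]
    have h₀ : convAssoc ℂ A 0 = 0 := by ext; simp [convAssoc]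
    rw [map_zero, map_zero, map_zero, map_zero, toConv_zero, toConv_zero, this]
    exact (congrArg (convAssoc ℂ A) (convMul_zero_mul _ _)).trans h₀ |>.symm
  | add t t' ht ht' =>
    have : convComulLeft ℂ A (toConv (endo₂ (t + t'))) =
        convComulLeft ℂ A (toConv (endo₂ t)) + convComulLeft ℂ A (toConv (endo₂ t')) := by
      ext; simp [convComulLeft]
    have h₁ (X Y) : convAssoc ℂ A (X + Y) = convAssoc ℂ A X + convAssoc ℂ A Y := by
      ext; simp [convAssoc]
    rw [this, map_add, map_add, map_add, toConv_add, ht, ht', ← h₁]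
    exact congrArg (convAssoc ℂ A) (convMul_add_mul _ _ _ _).symm
  | tmul u v =>
    have : endo₂ (Δ u) = (doubleComul (endo u)).ofConv := congr(($(hΔ u)).ofConv)
    rw [rTensor_tmul, endo₃_assoc_tmul, this]
    exact congrArg (convAssoc ℂ A) (toConv_map_doubleComul_endo _ _)

lemma coassoc_of_endo₂ [FiniteDimensional ℂ A] {Δ : (Module.Dual ℂ A ⊗[ℂ] A) →ₗ[ℂ]
      (Module.Dual ℂ A ⊗[ℂ] A) ⊗[ℂ] (Module.Dual ℂ A ⊗[ℂ] A)}
    (hΔ : ∀ u, toConv (endo₂ (Δ u)) = doubleComul (endo u)) (u : Module.Dual ℂ A ⊗[ℂ] A) :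
    TensorProduct.assoc ℂ _ _ _ (rTensor (Module.Dual ℂ A ⊗[ℂ] A) Δ (Δ u)) =
      lTensor (Module.Dual ℂ A ⊗[ℂ] A) Δ (Δ u) := by
  refine endo₃_injective (toConv_injective ?_)
  rw [endo₃_lTensor hΔ, endo₃_rTensor hΔ, hΔ, doubleComul_coassoc]

end Structure

end Transfer

section StructureMaps

variable {A : Type*} [Ring A] [HopfAlgebra ℂ A]
  (hS : ∀ a : A, antipode ℂ (antipode ℂ a) = a) {h : A}
  (hl : ∀ x : A, x * h = counit (R := ℂ) x • h)
  (hr : ∀ x : A, h * x = counit (R := ℂ) x • h) (h₁ : counit (R := ℂ) h = 1)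
  {φ : A →ₗ[ℂ] ℂ} {n : ℂ} (hn : n * φ h = 1)
  {ι κ μ ν : Type*} {s : Finset ι} {t : Finset κ} {r : Finset μ} {q : Finset ν}
  {φ₁ φ₂ φ₃ φ₄ : ι → Module.Dual ℂ A}
  (hφ : ∀ a b c d : A, ∑ i ∈ s, φ₁ i a * φ₂ i b * φ₃ i c * φ₄ i d = φ (a * b * c * d))
  {k₁ k₂ : ν → A} (hk : comul (R := ℂ) h = ∑ l ∈ q, k₁ l ⊗ₜ[ℂ] k₂ l)

lemma endo_conv_conv_tmul_apply (f g k : Module.Dual ℂ A) (y a : A) :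
    (endo (conv A (conv A f g) (dualAntipode A k) ⊗ₜ[ℂ] y)).ofConv a =
      ∑ p ∈ (ℛ ℂ a).index.sigma fun p => (ℛ ℂ ((ℛ ℂ a).left p)).index,
        (f ((ℛ ℂ ((ℛ ℂ a).left p.1)).left p.2) * g ((ℛ ℂ ((ℛ ℂ a).left p.1)).right p.2) *
          dualAntipode A k ((ℛ ℂ a).right p.1)) • y := by
  refine (endo_tmul_apply _ _ _).trans ?_
  rw [conv_eq, conv_eq, toConv_ofConv, ← Finset.sum_smul]
  exact congr($(convMul_mul_apply (toConv f) (toConv g) (toConv (dualAntipode A k)) a) • y)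

section Comul

variable {f : Module.Dual ℂ A} {f₁ f₂ : κ → Module.Dual ℂ A}
  (hf : ∀ a b : A, ∑ j ∈ t, f₁ j a * f₂ j b = f (a * b))
  {x : A} {x₁ x₂ : μ → A} (hx : comul (R := ℂ) x = ∑ k ∈ r, x₁ k ⊗ₜ[ℂ] x₂ k)

include hS hl hr h₁ hn hk in
lemma sum_integral_antipode_smul
    (hφl : ∀ x : A, TensorProduct.lid ℂ A (rTensor A φ (comul x)) = φ x • 1) (y : A) :
    ∑ l ∈ q, (n * φ (y * antipode ℂ (k₂ l))) • k₁ l = y := by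
  have := congr(n • $(rid_map_mulLeft_antipode_comul_integral hS hl hr h₁ hφl y))
  rw [smul_smul, hn, one_smul, hk] at this
  simpa [Finset.smul_sum, smul_smul] using this

include hS hl hr hn hk in
lemma sum_integral_smul
    (hφr : ∀ x : A, TensorProduct.rid ℂ A (lTensor A φ (comul x)) = φ x • 1) (a b : A) :
    ∑ l ∈ q, (n * φ (a * k₂ l * b)) • k₁ l = antipode ℂ a * antipode ℂ b := by
  have := congr(n • $(rid_map_mulLeft_mulRight_comul_integral hS hl hr hφr a b))
  rw [smul_smul, hn, one_smul, hk] at this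
  simpa [Finset.smul_sum, smul_smul, mul_assoc] using this

include hS hl hr h₁ hn hφ hk hf hx in
lemma sum_smul_tmul_eq
    (hφl : ∀ x : A, TensorProduct.lid ℂ A (rTensor A φ (comul x)) = φ x • 1) (b α β γ : A) :
    ∑ i ∈ s, ∑ j ∈ t, ∑ k ∈ r, ∑ l ∈ q, ((n * φ₂ i (x₂ k) * φ₄ i (antipode ℂ (k₂ l))) *
        (f₁ j b * (φ₁ i α * f₂ j β * φ₃ i γ))) • (x₁ k ⊗ₜ[ℂ] k₁ l) =
      inr ℂ A α * comul (f (b * β) • x) * inr ℂ A γ := by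
  simp only [← Finset.sum_product' s t, ← Finset.sum_product' r q]
  rw [Finset.sum_comm, Finset.sum_product r q, map_smul, hx]
  simp only [Finset.mul_sum, Finset.sum_mul, mul_smul_comm, smul_mul_assoc, inr,
    Algebra.TensorProduct.includeRight_apply, Algebra.TensorProduct.tmul_mul_tmul, one_mul, mul_one,
    Finset.smul_sum]
  refine Finset.sum_congr rfl fun k _ => ?_
  rw [← sum_integral_antipode_smul hS hl hr h₁ hn hk hφl (α * x₂ k * γ), TensorProduct.tmul_sum,
    Finset.smul_sum]
  refine Finset.sum_congr rfl fun l _ => ?_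
  rw [TensorProduct.tmul_smul, smul_smul, ← Finset.sum_smul, ← hφ, ← hf, Finset.mul_sum,
    Finset.sum_mul_sum, Finset.sum_comm, Finset.sum_product]
  congr 1
  refine Finset.sum_congr rfl fun i _ => Finset.sum_congr rfl fun j _ => ?_
  ring

include hS hl hr h₁ hn hφ hk hf hx in
lemma endo₂_eq_doubleComul
    (hφl : ∀ x : A, TensorProduct.lid ℂ A (rTensor A φ (comul x)) = φ x • 1) :
    toConv (endo₂ (∑ i ∈ s, ∑ j ∈ t, ∑ k ∈ r, ∑ l ∈ q,
        (n * φ₂ i (x₂ k) * φ₄ i (antipode ℂ (k₂ l))) •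
          ((conv A (conv A (φ₁ i) (f₂ j)) (dualAntipode A (φ₃ i)) ⊗ₜ[ℂ] x₁ k) ⊗ₜ[ℂ]
            (f₁ j ⊗ₜ[ℂ] k₁ l)))) = doubleComul (endo (f ⊗ₜ x)) := by
  ext a b
  change endo₂ _ (a ⊗ₜ b) = _
  refine Eq.trans ?_ (doubleComul_tmul _ a b).symm
  rw [convMul_mul_apply]
  simp only [map_sum, map_smul, endo₂_tmul, LinearMap.sum_apply, LinearMap.smul_apply,
    TensorProduct.map_tmul]
  simp only [endo_conv_conv_tmul_apply, TensorProduct.sum_tmul, Finset.smul_sum]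
  simp only [endo_tmul_apply]
  simp only [Finset.sum_comm (t := (ℛ ℂ a).index.sigma _)]
  refine Finset.sum_congr rfl fun p _ => ?_
  have h₂ : (endo (f ⊗ₜ[ℂ] x)).ofConv (b * (ℛ ℂ ((ℛ ℂ a).left p.1)).right p.2) =
    f (b * (ℛ ℂ ((ℛ ℂ a).left p.1)).right p.2) • x := endo_tmul_apply _ _ _
  simp only [comp_apply, mulLeft_apply, h₂]
  refine Eq.trans ?_ (sum_smul_tmul_eq hS hl hr h₁ hn hφ hk hf hx hφl b _ _ _)
  simp only [TensorProduct.tmul_smul, ← TensorProduct.smul_tmul', smul_smul, dualAntipode,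
    comp_apply]

end Comul

include hS hl hr hn hφ hk in
lemma endo_eq_doubleAntipode
    (hφr : ∀ x : A, TensorProduct.rid ℂ A (lTensor A φ (comul x)) = φ x • 1)
    (f : Module.Dual ℂ A) (x : A) :
    endo (∑ i ∈ s, ∑ l ∈ q, (n * φ₄ i x * φ₂ i (k₂ l)) •
          (conv A (conv A (φ₁ i) (dualAntipode A f)) (dualAntipode A (φ₃ i)) ⊗ₜ[ℂ] k₁ l)) =
      doubleAntipode (endo (f ⊗ₜ x)) := by
  ext a
  rw [doubleAntipode]
  refine Eq.trans ?_ (convMul_mul_apply _ _ _ a).symm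
  simp only [endo_sum, endo_smul, ofConv_sum, ofConv_smul, LinearMap.sum_apply,
    LinearMap.smul_apply, endo_conv_conv_tmul_apply, Finset.smul_sum]
  simp only [Finset.sum_comm (t := (ℛ ℂ a).index.sigma _)]
  refine Finset.sum_congr rfl fun p _ => ?_
  have h₂ := sum_integral_smul hS hl hr hn hk hφr ((ℛ ℂ ((ℛ ℂ a).left p.1)).left p.2)
    (antipode ℂ ((ℛ ℂ a).right p.1) * x)
  have h₃ : (endo (f ⊗ₜ[ℂ] x)).ofConv (antipode ℂ ((ℛ ℂ ((ℛ ℂ a).left p.1)).right p.2)) =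
    f (antipode ℂ ((ℛ ℂ ((ℛ ℂ a).left p.1)).right p.2)) • x := endo_tmul_apply _ _ _
  rw [antipode_mul_antidistrib, hS] at h₂
  simp only [comp_apply, h₃, id_apply, map_smul, mul_smul_comm, smul_mul_assoc, mul_assoc]
  rw [← h₂, Finset.sum_comm, Finset.smul_sum]
  refine Finset.sum_congr rfl fun l _ => ?_
  rw [← mul_assoc _ _ x, ← hφ, Finset.mul_sum, Finset.sum_smul, Finset.smul_sum]
  refine Finset.sum_congr rfl fun i _ => ?_
  simp only [smul_smul, dualAntipode, comp_apply]
  congr 1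
  ring

section Families

variable [FiniteDimensional ℂ A]

lemma exists_sum_dual_mul (f : Module.Dual ℂ A) :
    ∃ f₁ f₂ : Fin (Module.finrank ℂ A) → Module.Dual ℂ A,
      ∀ a b : A, ∑ j, f₁ j a * f₂ j b = f (a * b) := by
  let c := Module.finBasis ℂ A
  refine ⟨fun j => c.coord j, fun j => f ∘ₗ mulLeft ℂ (c j), fun a b => ?_⟩
  conv_rhs => rw [← c.sum_repr a, Finset.sum_mul, map_sum]
  simp

lemma exists_sum_dual_mul_mul_mul (f : Module.Dual ℂ A) :
    ∃ f₁ f₂ f₃ f₄ : Fin (Module.finrank ℂ A) × Fin (Module.finrank ℂ A) ×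
        Fin (Module.finrank ℂ A) → Module.Dual ℂ A,
      ∀ a b c d : A, ∑ i, f₁ i a * f₂ i b * f₃ i c * f₄ i d = f (a * b * c * d) := by
  let e := Module.finBasis ℂ A
  refine ⟨fun i => e.coord i.1, fun i => e.coord i.2.1, fun i => e.coord i.2.2,
    fun i => f ∘ₗ mulLeft ℂ (e i.1 * e i.2.1 * e i.2.2), fun a b c d => ?_⟩
  simp only [Fintype.sum_prod_type]
  conv_rhs => rw [← e.sum_repr a, Finset.sum_mul, Finset.sum_mul, Finset.sum_mul, map_sum]
  refine Finset.sum_congr rfl fun i _ => ?_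
  conv_rhs => rw [← e.sum_repr b, Finset.mul_sum, Finset.sum_mul, Finset.sum_mul, map_sum]
  refine Finset.sum_congr rfl fun j _ => ?_
  conv_rhs => rw [← e.sum_repr c, Finset.mul_sum, Finset.sum_mul, map_sum]
  refine Finset.sum_congr rfl fun k _ => ?_
  simp [mul_assoc, mul_left_comm]

end Families

lemma exists_comul_eq_sum (x : A) : ∃ (d : ℕ) (x₁ x₂ : Fin d → A),
    comul (R := ℂ) x = ∑ k, x₁ k ⊗ₜ[ℂ] x₂ k := by
  obtain ⟨S, hS⟩ := TensorProduct.exists_finset (comul (R := ℂ) x)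
  refine ⟨S.card, fun k => (S.equivFin.symm k).1.1, fun k => (S.equivFin.symm k).1.2, ?_⟩
  rw [hS, ← S.sum_coe_sort]
  exact (S.equivFin.symm.sum_comp fun p => p.1.1 ⊗ₜ[ℂ] p.1.2).symm

end StructureMaps

section Counit

variable {A : Type*} [Ring A] [HopfAlgebra ℂ A] {ε : (Module.Dual ℂ A ⊗[ℂ] A) →ₗ[ℂ] ℂ}
  (hε : ∀ (f : Module.Dual ℂ A) (x : A), ε (f ⊗ₜ[ℂ] x) = f 1 * counit (R := ℂ) x)
  (t : (Module.Dual ℂ A ⊗[ℂ] A) ⊗[ℂ] (Module.Dual ℂ A ⊗[ℂ] A)) (a : A)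

include hε in
lemma endo_lid_rTensor :
    endo (TensorProduct.lid ℂ _ (rTensor (Module.Dual ℂ A ⊗[ℂ] A) ε t)) a =
      TensorProduct.lid ℂ A (TensorProduct.map counit .id (endo₂ t (1 ⊗ₜ a))) := by
  induction t with
  | zero => simp [endo_zero]
  | add t t' ht ht' => simp [endo_add, ht, ht']
  | tmul u v => simp [endo_smul, counit_endo_one hε]

include hε in
lemma endo_rid_lTensor :
    endo (TensorProduct.rid ℂ _ (lTensor (Module.Dual ℂ A ⊗[ℂ] A) ε t)) a =
      TensorProduct.rid ℂ A (TensorProduct.map .id counit (endo₂ t (a ⊗ₜ 1))) := by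
  induction t with
  | zero => simp [endo_zero]
  | add t t' ht ht' => simp [endo_add, ht, ht']
  | tmul u v => simp [endo_smul, counit_endo_one hε]

variable {Δ : (Module.Dual ℂ A ⊗[ℂ] A) →ₗ[ℂ]
    (Module.Dual ℂ A ⊗[ℂ] A) ⊗[ℂ] (Module.Dual ℂ A ⊗[ℂ] A)}
  (hΔ : ∀ u, toConv (endo₂ (Δ u)) = doubleComul (endo u)) (u : Module.Dual ℂ A ⊗[ℂ] A)

include hε hΔ in
lemma lid_rTensor_counit_of_endo₂ [FiniteDimensional ℂ A] :
    TensorProduct.lid ℂ _ (rTensor (Module.Dual ℂ A ⊗[ℂ] A) ε (Δ u)) = u := by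
  refine endo_injective ?_
  ext a
  have h : endo₂ (Δ u) (1 ⊗ₜ a) = comul (R := ℂ) (endo u a) :=
    congr($(hΔ u) (1 ⊗ₜ a)).trans (doubleComul_one_tmul _ a)
  rw [endo_lid_rTensor hε, h]
  exact congr(TensorProduct.lid ℂ A $(rTensor_counit_comul (R := ℂ) (endo u a))).trans
    (by simp)

include hε hΔ in
lemma rid_lTensor_counit_of_endo₂ [FiniteDimensional ℂ A] :
    TensorProduct.rid ℂ _ (lTensor (Module.Dual ℂ A ⊗[ℂ] A) ε (Δ u)) = u := by
  refine endo_injective ?_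
  ext a
  have h : endo₂ (Δ u) (a ⊗ₜ 1) = doubleComul (endo u) (a ⊗ₜ 1) := congr($(hΔ u) (a ⊗ₜ 1))
  rw [endo_rid_lTensor hε, h]
  exact rid_map_counit_doubleComul _ _

end Counit

section Mul

variable {A : Type*} [Ring A] [HopfAlgebra ℂ A]
  {m : (Module.Dual ℂ A ⊗[ℂ] A) →ₗ[ℂ] (Module.Dual ℂ A ⊗[ℂ] A) →ₗ[ℂ] (Module.Dual ℂ A ⊗[ℂ] A)}

lemma endo₂_sum_mul_tmul_mul (hm : ∀ u v, endo (m u v) = endo v * endo u) {ι κ : Type*}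
    (s : Finset ι) (t : Finset κ) (u₁ u₂ : ι → Module.Dual ℂ A ⊗[ℂ] A)
    (v₁ v₂ : κ → Module.Dual ℂ A ⊗[ℂ] A) :
    toConv (endo₂ (∑ i ∈ s, ∑ j ∈ t, m (u₁ i) (v₁ j) ⊗ₜ[ℂ] m (u₂ i) (v₂ j))) =
      toConv (∑ j ∈ t, TensorProduct.map (endo (v₁ j)).ofConv (endo (v₂ j)).ofConv) *
        toConv (∑ i ∈ s, TensorProduct.map (endo (u₁ i)).ofConv (endo (u₂ i)).ofConv) := by
  simp only [map_sum, endo₂_tmul, hm, toConv_sum]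
  rw [Finset.sum_mul_sum, Finset.sum_comm]
  refine Finset.sum_congr rfl fun j _ => Finset.sum_congr rfl fun i _ => ?_
  rw [TensorProduct.map_convMul_map]

end Mul

end HopfAlgebra

open HopfAlgebra WithConv

/-- Let `H` be a finite-dimensional Hopf algebra over `ℂ` with involutive antipode, `h ∈ H` a
normalized two-sided integral, `φ ∈ H*` a normalized two-sided integral functional with
`φ(h) = 1/dim H` and `δ = √(dim H)`.  Then `H* ⊗ H` is a Hopf algebra with multiplication
`(f⊗x)(g⊗y) = gf ⊗ yx`, unit `ε ⊗ 1`, comultiplication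
`Δ(f⊗x) = δ² φ₂(x₂) φ₄(S(h₂)) (φ₁f₂S(φ₃) ⊗ x₁) ⊗ (f₁ ⊗ h₁)`, counit `f⊗x ↦ f(1)ε(x)` and
antipode `f⊗x ↦ δ² φ₄(x) φ₂(h₂) (φ₁S(f)S(φ₃) ⊗ h₁)` (iterated coproducts in `H*` are encoded
by finite families of functionals dual to iterated products of `H`): any linear structure maps
realizing these formulas satisfy all the Hopf algebra axioms. -/
theorem drinfeldDoubleDual_structureMaps_hopf
    [FiniteDimensional ℂ H]
    (hS : ∀ x : H, HopfAlgebra.antipode (R := ℂ) (HopfAlgebra.antipode (R := ℂ) x) = x)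
    (h : H)
    (hh_left : ∀ x : H, x * h = Coalgebra.counit (R := ℂ) x • h)
    (hh_right : ∀ x : H, h * x = Coalgebra.counit (R := ℂ) x • h)
    (hh_one : Coalgebra.counit (R := ℂ) h = 1)
    (φ : Module.Dual ℂ H)
    (hφ_left : ∀ x : H,
      TensorProduct.lid ℂ H (LinearMap.rTensor H φ (Coalgebra.comul (R := ℂ) x)) = φ x • 1)
    (hφ_right : ∀ x : H,
      TensorProduct.rid ℂ H (LinearMap.lTensor H φ (Coalgebra.comul (R := ℂ) x)) = φ x • 1)
    (hφ_one : φ 1 = 1)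
    (hφh : φ h = 1 / (Module.finrank ℂ H : ℂ))
    (δ : ℂ) (hδ : δ = (Real.sqrt (Module.finrank ℂ H) : ℂ))
    (m : (Module.Dual ℂ H ⊗[ℂ] H) →ₗ[ℂ] (Module.Dual ℂ H ⊗[ℂ] H) →ₗ[ℂ]
      (Module.Dual ℂ H ⊗[ℂ] H))
    (hm : ∀ (f g : Module.Dual ℂ H) (x y : H),
      m (f ⊗ₜ[ℂ] x) (g ⊗ₜ[ℂ] y) = conv H g f ⊗ₜ[ℂ] (y * x))
    (cm : (Module.Dual ℂ H ⊗[ℂ] H) →ₗ[ℂ]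
      (Module.Dual ℂ H ⊗[ℂ] H) ⊗[ℂ] (Module.Dual ℂ H ⊗[ℂ] H))
    (hcm : ∀ (f : Module.Dual ℂ H) (x : H)
        (ι κ μ ν : Type) (s : Finset ι) (t : Finset κ) (r : Finset μ) (q : Finset ν)
        (φ₁ φ₂ φ₃ φ₄ : ι → Module.Dual ℂ H) (f₁ f₂ : κ → Module.Dual ℂ H)
        (x₁ x₂ : μ → H) (h₁ h₂ : ν → H),
      (∀ a b c d : H, ∑ i ∈ s, φ₁ i a * φ₂ i b * φ₃ i c * φ₄ i d = φ (a * b * c * d)) →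
      (∀ a b : H, ∑ j ∈ t, f₁ j a * f₂ j b = f (a * b)) →
      Coalgebra.comul (R := ℂ) x = ∑ k ∈ r, x₁ k ⊗ₜ[ℂ] x₂ k →
      Coalgebra.comul (R := ℂ) h = ∑ l ∈ q, h₁ l ⊗ₜ[ℂ] h₂ l →
      cm (f ⊗ₜ[ℂ] x) = ∑ i ∈ s, ∑ j ∈ t, ∑ k ∈ r, ∑ l ∈ q,
        (δ ^ 2 * φ₂ i (x₂ k) * φ₄ i (HopfAlgebra.antipode (R := ℂ) (h₂ l))) •
          ((conv H (conv H (φ₁ i) (f₂ j)) (dualAntipode H (φ₃ i)) ⊗ₜ[ℂ] x₁ k) ⊗ₜ[ℂ]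
            (f₁ j ⊗ₜ[ℂ] h₁ l)))
    (cu : (Module.Dual ℂ H ⊗[ℂ] H) →ₗ[ℂ] ℂ)
    (hcu : ∀ (f : Module.Dual ℂ H) (x : H),
      cu (f ⊗ₜ[ℂ] x) = f 1 * Coalgebra.counit (R := ℂ) x)
    (S' : (Module.Dual ℂ H ⊗[ℂ] H) →ₗ[ℂ] (Module.Dual ℂ H ⊗[ℂ] H))
    (hS' : ∀ (f : Module.Dual ℂ H) (x : H)
        (ι ν : Type) (s : Finset ι) (q : Finset ν)
        (φ₁ φ₂ φ₃ φ₄ : ι → Module.Dual ℂ H) (h₁ h₂ : ν → H),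
      (∀ a b c d : H, ∑ i ∈ s, φ₁ i a * φ₂ i b * φ₃ i c * φ₄ i d = φ (a * b * c * d)) →
      Coalgebra.comul (R := ℂ) h = ∑ l ∈ q, h₁ l ⊗ₜ[ℂ] h₂ l →
      S' (f ⊗ₜ[ℂ] x) = ∑ i ∈ s, ∑ l ∈ q,
        (δ ^ 2 * φ₄ i x * φ₂ i (h₂ l)) •
          (conv H (conv H (φ₁ i) (dualAntipode H f)) (dualAntipode H (φ₃ i)) ⊗ₜ[ℂ] h₁ l)) :
    -- associativity and unitality of the multiplication
    (∀ u v w : Module.Dual ℂ H ⊗[ℂ] H, m (m u v) w = m u (m v w)) ∧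
    (∀ u : Module.Dual ℂ H ⊗[ℂ] H,
      m ((Coalgebra.counit (R := ℂ) : Module.Dual ℂ H) ⊗ₜ[ℂ] (1 : H)) u = u) ∧
    (∀ u : Module.Dual ℂ H ⊗[ℂ] H,
      m u ((Coalgebra.counit (R := ℂ) : Module.Dual ℂ H) ⊗ₜ[ℂ] (1 : H)) = u) ∧
    -- coassociativity and counitality of the comultiplication
    (∀ u : Module.Dual ℂ H ⊗[ℂ] H,
      TensorProduct.assoc ℂ (Module.Dual ℂ H ⊗[ℂ] H) (Module.Dual ℂ H ⊗[ℂ] H)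
        (Module.Dual ℂ H ⊗[ℂ] H) (LinearMap.rTensor (Module.Dual ℂ H ⊗[ℂ] H) cm (cm u)) =
      LinearMap.lTensor (Module.Dual ℂ H ⊗[ℂ] H) cm (cm u)) ∧
    (∀ u : Module.Dual ℂ H ⊗[ℂ] H,
      TensorProduct.lid ℂ (Module.Dual ℂ H ⊗[ℂ] H)
        (LinearMap.rTensor (Module.Dual ℂ H ⊗[ℂ] H) cu (cm u)) = u) ∧
    (∀ u : Module.Dual ℂ H ⊗[ℂ] H,
      TensorProduct.rid ℂ (Module.Dual ℂ H ⊗[ℂ] H)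
        (LinearMap.lTensor (Module.Dual ℂ H ⊗[ℂ] H) cu (cm u)) = u) ∧
    -- the comultiplication and counit are unital algebra maps
    (∀ (u v : Module.Dual ℂ H ⊗[ℂ] H) (ι κ : Type) (s : Finset ι) (t : Finset κ)
        (u₁ u₂ : ι → Module.Dual ℂ H ⊗[ℂ] H) (v₁ v₂ : κ → Module.Dual ℂ H ⊗[ℂ] H),
      cm u = ∑ i ∈ s, u₁ i ⊗ₜ[ℂ] u₂ i → cm v = ∑ j ∈ t, v₁ j ⊗ₜ[ℂ] v₂ j →
      cm (m u v) = ∑ i ∈ s, ∑ j ∈ t, m (u₁ i) (v₁ j) ⊗ₜ[ℂ] m (u₂ i) (v₂ j)) ∧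
    cm ((Coalgebra.counit (R := ℂ) : Module.Dual ℂ H) ⊗ₜ[ℂ] (1 : H)) =
      ((Coalgebra.counit (R := ℂ) : Module.Dual ℂ H) ⊗ₜ[ℂ] (1 : H)) ⊗ₜ[ℂ]
        ((Coalgebra.counit (R := ℂ) : Module.Dual ℂ H) ⊗ₜ[ℂ] (1 : H)) ∧
    (∀ u v : Module.Dual ℂ H ⊗[ℂ] H, cu (m u v) = cu u * cu v) ∧
    cu ((Coalgebra.counit (R := ℂ) : Module.Dual ℂ H) ⊗ₜ[ℂ] (1 : H)) = 1 ∧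
    -- the antipode axioms
    (∀ (u : Module.Dual ℂ H ⊗[ℂ] H) (ι : Type) (s : Finset ι)
        (u₁ u₂ : ι → Module.Dual ℂ H ⊗[ℂ] H),
      cm u = ∑ i ∈ s, u₁ i ⊗ₜ[ℂ] u₂ i →
      (∑ i ∈ s, m (S' (u₁ i)) (u₂ i)) =
        cu u • ((Coalgebra.counit (R := ℂ) : Module.Dual ℂ H) ⊗ₜ[ℂ] (1 : H)) ∧
      (∑ i ∈ s, m (u₁ i) (S' (u₂ i))) =
        cu u • ((Coalgebra.counit (R := ℂ) : Module.Dual ℂ H) ⊗ₜ[ℂ] (1 : H))) := by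
  have hn : δ ^ 2 * φ h = 1 := by
    have : Module.finrank ℂ H ≠ 0 := fun h₀ => by
      have := Module.finrank_zero_iff.mp h₀
      simp [Subsingleton.elim (1 : H) 0] at hφ_one
    rw [hδ, hφh, ← Complex.ofReal_pow, Real.sq_sqrt (Nat.cast_nonneg _)]
    simp [this]
  obtain ⟨d, k₁, k₂, hk⟩ := exists_comul_eq_sum h
  obtain ⟨φ₁, φ₂, φ₃, φ₄, hφ⟩ := exists_sum_dual_mul_mul_mul φ
  have hΔ (u : Module.Dual ℂ H ⊗[ℂ] H) : toConv (endo₂ (cm u)) = doubleComul (endo u) := by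
    induction u with
    | zero => rw [map_zero, map_zero, endo_zero, doubleComul_zero, toConv_zero]
    | add u v hu hv => rw [map_add, map_add, toConv_add, hu, hv, endo_add, doubleComul_add]
    | tmul f x =>
      obtain ⟨e, x₁, x₂, hx⟩ := exists_comul_eq_sum x
      obtain ⟨f₁, f₂, hf⟩ := exists_sum_dual_mul f
      rw [hcm f x _ _ _ _ _ _ _ _ φ₁ φ₂ φ₃ φ₄ f₁ f₂ x₁ x₂ k₁ k₂ hφ hf hx hk]
      exact endo₂_eq_doubleComul hS hh_left hh_right hh_one hn hφ hk hf hx hφ_left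
  have hS'' (u : Module.Dual ℂ H ⊗[ℂ] H) : endo (S' u) = doubleAntipode (endo u) := by
    induction u with
    | zero => rw [map_zero, endo_zero, doubleAntipode_zero]
    | add u v hu hv => rw [map_add, endo_add, endo_add, doubleAntipode_add, hu, hv]
    | tmul f x =>
      rw [hS' f x _ _ _ _ φ₁ φ₂ φ₃ φ₄ k₁ k₂ hφ hk]
      exact endo_eq_doubleAntipode hS hh_left hh_right hn hφ hk hφ_right f x
  have hμ := endo_mul hm
  have hsum {u : Module.Dual ℂ H ⊗[ℂ] H} {ι : Type} {s : Finset ι}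
      {u₁ u₂ : ι → Module.Dual ℂ H ⊗[ℂ] H} (h : cm u = ∑ i ∈ s, u₁ i ⊗ₜ[ℂ] u₂ i) :
      doubleComul (endo u) =
        toConv (∑ i ∈ s, TensorProduct.map (endo (u₁ i)).ofConv (endo (u₂ i)).ofConv) := by
    rw [← hΔ, h, map_sum]; rfl
  refine ⟨fun u v w => endo_injective ?_, fun u => endo_injective ?_, fun u => endo_injective ?_,
    coassoc_of_endo₂ hΔ, fun u => lid_rTensor_counit_of_endo₂ hcu hΔ u,
    fun u => rid_lTensor_counit_of_endo₂ hcu hΔ u,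
    fun u v ι κ s t u₁ u₂ v₁ v₂ hu hv => endo₂_injective (toConv_injective ?_),
    endo₂_injective (toConv_injective ?_), fun u v => ?_, ?_,
    fun u ι s u₁ u₂ hu => ⟨endo_injective ?_, endo_injective ?_⟩⟩
  · simp only [hμ, mul_assoc]
  · rw [hμ, endo_counit_tmul_one, mul_one]
  · rw [hμ, endo_counit_tmul_one, one_mul]
  · rw [hΔ, hμ, map_mul, hsum hu, hsum hv]
    exact (endo₂_sum_mul_tmul_mul hμ s t u₁ u₂ v₁ v₂).symm
  · rw [hΔ, endo₂_tmul, endo_counit_tmul_one, map_one, toConv_map_one_one]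
  · rw [← counit_endo_one hcu, ← counit_endo_one hcu, ← counit_endo_one hcu, hμ]
    simp [LinearMap.convMul_apply, Algebra.TensorProduct.one_def, mul_comm]
  · simp [hcu]
  · simp only [endo_sum, hμ, hS'']
    rw [endo_smul, endo_counit_tmul_one, ← counit_endo_one hcu]
    exact sum_mul_doubleAntipode hS s _ _ (hsum hu)
  · simp only [endo_sum, hμ, hS'']
    rw [endo_smul, endo_counit_tmul_one, ← counit_endo_one hcu]
    exact sum_doubleAntipode_mul hS s _ _ (hsum hu)
end
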